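/- Let P be a predicate on the positive integers such that both P and ¬P hold for infinitely many positive integers. If f_{¬P}(m+1) − f_{¬P}(m) ≥ m for all positive integers m, then for every positive integer n: f_P(n) = n + C_{¬P}(n) + 1 if n + C_{¬P}(n) ≥ f_{¬P}(C_{¬P}(n) + 1), and f_P(n) = n + C_{¬P}(n) otherwise. -/

import Mathlib

/-- `nthSat P n` is the `n`-th positive integer (indexed from `n = 1`) satisfying `P`. -/
noncomputable def nthSat (P : ℕ → Prop) (n : ℕ) : ℕ :=
  Nat.nth (fun m => 0 < m ∧ P m) (n - 1)

/-- `countSat P x` is the number of positive integers `m ≤ x` satisfying `P`. -/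
noncomputable def countSat (P : ℕ → Prop) (x : ℕ) : ℕ :=
  {m : ℕ | 0 < m ∧ m ≤ x ∧ P m}.ncard

open Classical in
theorem aux_countSat (P : ℕ → Prop) (n : ℕ) :
    countSat P n = Nat.count (fun m => 0 < m ∧ P m) (n + 1) := by
  rw [Nat.count_eq_card_filter_range, ← Set.ncard_coe_finset]
  unfold countSat
  congr 1
  ext m
  simp
  grind

open Classical in
theorem aux_count_add (P : ℕ → Prop) (n : ℕ) :
    Nat.count (fun m => 0 < m ∧ P m) (n + 1) + Nat.count (fun m => 0 < m ∧ ¬ P m) (n + 1) = n := by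
  induction n with
  | zero => simp [Nat.count_succ]
  | succ k ih =>
    rw [Nat.count_succ, Nat.count_succ _ (k + 1)]
    by_cases h : P (k + 1) <;> simp [h] <;> omega

theorem stmt_2 (P : ℕ → Prop)
    (hP : {m : ℕ | 0 < m ∧ P m}.Infinite)
    (hP' : {m : ℕ | 0 < m ∧ ¬ P m}.Infinite)
    (hgap : ∀ m : ℕ, 0 < m →
      m ≤ nthSat (fun x => ¬ P x) (m + 1) - nthSat (fun x => ¬ P x) m)
    (n : ℕ) (hn : 0 < n) :
    (n + countSat (fun x => ¬ P x) n ≥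
        nthSat (fun x => ¬ P x) (countSat (fun x => ¬ P x) n + 1) →
      nthSat P n = n + countSat (fun x => ¬ P x) n + 1) ∧
    (n + countSat (fun x => ¬ P x) n <
        nthSat (fun x => ¬ P x) (countSat (fun x => ¬ P x) n + 1) →
      nthSat P n = n + countSat (fun x => ¬ P x) n) := by
  classical
  have hc := aux_countSat (fun x => ¬ P x) n
  unfold nthSat at *
  set q : ℕ → Prop := fun m => 0 < m ∧ ¬ P m with hq
  set p : ℕ → Prop := fun m => 0 < m ∧ P m with hp
  have hadd : ∀ N, Nat.count p (N + 1) + Nat.count q (N + 1) = N := aux_count_add P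
  have hle : ∀ a b, Nat.count q a ≤ b ↔ a ≤ Nat.nth q b := fun a b =>
    Nat.count_le_iff_le_nth hP'
  have hnth : ∀ N, p N → Nat.nth p (Nat.count p N) = N := fun N h => Nat.nth_count h
  have hpq : ∀ N, 0 < N → ¬ q N → p N := by
    intro N h1 h2
    simp only [hq, hp] at *
    tauto
  have hmono : ∀ a b, a ≤ b → Nat.count q a ≤ Nat.count q b := fun a b h =>
    Nat.count_monotone q h
  have hsucc : ∀ N, q N → Nat.count q (N + 1) = Nat.count q N + 1 := fun N h => by
    rw [Nat.count_succ, if_pos h]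
  have hsucc' : ∀ N, ¬ q N → Nat.count q (N + 1) = Nat.count q N := fun N h => by
    rw [Nat.count_succ, if_neg h]; rfl
  obtain ⟨k, hk⟩ : ∃ k, k = Nat.count q (n + 1) := ⟨_, rfl⟩
  have hck : countSat (fun x => ¬ P x) n = k := by
    rw [hc, hk]
    congr!
  rw [hck]
  change (n + k ≥ Nat.nth q k → Nat.nth p (n - 1) = n + k + 1) ∧
    (n + k < Nat.nth q k → Nat.nth p (n - 1) = n + k)
  constructor
  · intro h
    have g := hgap (k + 1) (by omega)
    simp only [Nat.add_sub_cancel] at g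
    have a1 := (hle (n + 1) k).1 hk.symm.le
    have a2 := (hle (n + k + 1 + 1) (k + 1)).2 (by omega)
    have a3 := hle (n + k + 1) k
    have a4 := hmono (n + k + 1) (n + k + 1 + 1) (by omega)
    have nq : ¬ q (n + k + 1) := fun c => by
      have := hsucc _ c
      omega
    have r := hnth _ (hpq _ (by omega) nq)
    have s := hadd (n + k)
    rwa [show Nat.count p (n + k + 1) = n - 1 by omega] at r
  · intro h
    have a1 := (hle (n + k + 1) k).2 h
    have nq : ¬ q (n + k) := fun c => by
      have := hsucc _ c
      rcases Nat.eq_zero_or_pos k with h0 | h0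
      · omega
      · have := hmono (n + 1) (n + k) (by omega)
        omega
    have a2 := hsucc' _ nq
    have a3 := hmono (n + 1) (n + k + 1) (by omega)
    have pp := hpq _ (by omega) nq
    have r := hnth _ pp
    have s := hadd (n + k - 1)
    rw [show n + k - 1 + 1 = n + k by omega] at s
    rwa [show Nat.count p (n + k) = n - 1 by omega] at r
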